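/- arXiv:2301.12681 — 2 statements merged into one kernel-verified Lean document; each statement's English description precedes it below -/
import Mathlib

section
/- Let R be an integral domain, 1 ≤ d ≤ n, B = R[x₁^{±1}, …, x_d^{±1}, x_{d+1}, …, xₙ], φ : B → B an R-algebra homomorphism with φ ∘ φ = φ, A = φ(B), and r the rank of the abelian group U_R(A) = A^*/R^*. Then r ≤ tr.deg_R A ≤ r + n − d, where tr.deg_R A is the transcendence degree of the fraction field of A over the fraction field of R. -/
/-- The transcendence degree of an `R`-algebra `A`: the supremum of the cardinalities of
algebraically independent subsets of `A` over `R`.  For an integral domain `A` over an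
integral domain `R` this equals the transcendence degree of `Q(A)` over `Q(R)`. -/
noncomputable def trdeg (R A : Type*) [CommRing R] [CommRing A] [Algebra R A] : Cardinal :=
  ⨆ s : { s : Set A // AlgebraicIndependent R ((↑) : s → A) }, Cardinal.mk s.1

/-- The (torsion-free) rank of an abelian group, written multiplicatively. -/
noncomputable def groupRank (G : Type*) [CommGroup G] : Cardinal :=
  @Module.rank ℤ (Additive G) _ _ (AddCommGroup.toIntModule _)

/-- The mixed Laurent/polynomial ring `R[x₁^{±1}, …, x_d^{±1}, x_{d+1}, …, x_{d+m}]`,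
realized as the monoid algebra of `ℤ^d × ℕ^m` over `R`. -/
abbrev MixedLaurent (R : Type*) [CommRing R] (d m : ℕ) : Type _ :=
  AddMonoidAlgebra R ((Fin d → ℤ) × (Fin m → ℕ))

/-- `U_R(A) = A^*/R^*`, the quotient of the unit group of `A` by the image of `R^*`. -/
abbrev URGroup (R A : Type*) [CommRing R] [CommRing A] [Algebra R A] : Type _ :=
  Aˣ ⧸ (Units.map (algebraMap R A : R →* A)).range

theorem LinearIndependent.int_of_nat {ι M : Type*} [AddCommGroup M] {v : ι → M}
    (hv : LinearIndependent ℕ v) : LinearIndependent ℤ v := by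
  rw [linearIndependent_iff]
  intro l hl
  let a : ι →₀ ℕ := l.mapRange Int.toNat rfl
  let b : ι →₀ ℕ := (-l).mapRange Int.toNat rfl
  have hab : l = a.mapRange (Nat.cast : ℕ → ℤ) rfl - b.mapRange (Nat.cast : ℕ → ℤ) rfl := by
    ext i
    simp only [a, b, Finsupp.sub_apply, Finsupp.mapRange_apply, Finsupp.neg_apply]
    omega
  have hcast (c : ι →₀ ℕ) : Finsupp.linearCombination ℤ v (c.mapRange (Nat.cast : ℕ → ℤ) rfl) =
      Finsupp.linearCombination ℕ v c := by
    rw [Finsupp.linearCombination_apply, Finsupp.linearCombination_apply,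
      Finsupp.sum_mapRange_index (by simp)]
    simp
  have h : a = b := hv (by
    rw [← sub_eq_zero, ← hcast, ← hcast, ← map_sub, ← hab, hl])
  rw [hab, h, sub_self]

theorem linearCombination_ofMul {ι G : Type*} [CommGroup G] (v : ι → G) (l : ι →₀ ℕ) :
    Finsupp.linearCombination ℕ (fun i ↦ Additive.ofMul (v i)) l =
      Additive.ofMul (l.prod fun i n ↦ v i ^ n) := by
  rw [Finsupp.linearCombination_apply, Finsupp.sum, Finsupp.prod, ofMul_prod]
  rfl

theorem mk_le_groupRank.{u} {ι G : Type u} [CommGroup G] {v : ι → G}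
    (hv : Function.Injective fun l : ι →₀ ℕ ↦ l.prod fun i n ↦ v i ^ n) :
    Cardinal.mk ι ≤ groupRank G := by
  have h : LinearIndependent ℕ (fun i ↦ Additive.ofMul (v i)) := fun l l' hl ↦
    hv (Additive.ofMul.injective (by simpa only [linearCombination_ofMul] using hl))
  exact h.int_of_nat.cardinal_le_rank

theorem exists_injective_of_natCast_le_groupRank {G : Type*} [CommGroup G] {r : ℕ}
    (hr : (r : Cardinal) ≤ groupRank G) :
    ∃ v : Fin r → G, Function.Injective fun l : Fin r →₀ ℕ ↦ l.prod fun i n ↦ v i ^ n := by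
  obtain ⟨v, hv⟩ := Module.le_rank_iff.1 hr
  refine ⟨fun i ↦ (v i).toMul, fun l l' h ↦ hv.restrict_scalars' ℕ ?_⟩
  have := congrArg Additive.ofMul h
  simpa only [← linearCombination_ofMul, ofMul_toMul] using this

theorem QuotientGroup.mk_finsuppProd_pow {ι G : Type*} [CommGroup G] (H : Subgroup G) (u : ι → G)
    (l : ι →₀ ℕ) :
    ((l.prod fun i n ↦ u i ^ n : G) : G ⧸ H) = l.prod fun i n ↦ (u i : G ⧸ H) ^ n :=
  map_finsuppProd (QuotientGroup.mk' H) l _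

theorem urGroup_prod_eq_iff {ι R A : Type*} [CommRing R] [CommRing A] [Algebra R A]
    (u : ι → Aˣ) (l l' : ι →₀ ℕ) :
    (l.prod fun i n ↦ (u i : URGroup R A) ^ n) = (l'.prod fun i n ↦ (u i : URGroup R A) ^ n) ↔
      ∃ c : Rˣ, (l.prod fun i n ↦ (u i : A) ^ n) =
        algebraMap R A c * (l'.prod fun i n ↦ (u i : A) ^ n) := by
  have hmk (l : ι →₀ ℕ) : (l.prod fun i n ↦ (u i : URGroup R A) ^ n) =
      ((l.prod fun i n ↦ u i ^ n : Aˣ) : URGroup R A) :=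
    (QuotientGroup.mk_finsuppProd_pow _ u l).symm
  have hval (l : ι →₀ ℕ) : ((l.prod fun i n ↦ u i ^ n : Aˣ) : A) =
      l.prod fun i n ↦ (u i : A) ^ n := by
    simp [Finsupp.prod]
  rw [hmk, hmk, eq_comm, QuotientGroup.eq]
  refine exists_congr fun c ↦ ?_
  rw [eq_inv_mul_iff_mul_eq, Units.ext_iff, eq_comm, Units.val_mul, hval, hval, mul_comm]
  rfl

theorem AlgebraicIndependent.injective_urGroup_prod {ι R A : Type*} [CommRing R] [Nontrivial R]
    [CommRing A] [Algebra R A] {u : ι → Aˣ} (hu : AlgebraicIndependent R (fun i ↦ (u i : A))) :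
    Function.Injective fun l : ι →₀ ℕ ↦ l.prod fun i n ↦ (u i : URGroup R A) ^ n := by
  intro l l' h
  obtain ⟨c, hc⟩ := (urGroup_prod_eq_iff u l l').1 h
  have hmon : MvPolynomial.monomial l (1 : R) = MvPolynomial.monomial l' (c : R) := hu (by
    rw [MvPolynomial.aeval_monomial, MvPolynomial.aeval_monomial, map_one, one_mul, hc])
  rw [MvPolynomial.monomial_eq_monomial_iff] at hmon
  exact (hmon.resolve_right fun h ↦ one_ne_zero h.1).1

theorem AddMonoidAlgebra.algebraicIndependent_single {ι R G : Type*} [CommRing R] [AddCommMonoid G]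
    {g : ι → G} (c : ι → Rˣ) (hg : LinearIndependent ℕ g) :
    AlgebraicIndependent R (fun i ↦ AddMonoidAlgebra.single (g i) (c i : R)) := by
  classical
  rw [algebraicIndependent_iff]
  intro p hp
  ext l₀
  let C (l : ι →₀ ℕ) : Rˣ := l.prod fun i n ↦ c i ^ n
  have hp' : MvPolynomial.aeval (fun i ↦ AddMonoidAlgebra.single (g i) (c i : R)) p =
      ∑ l ∈ p.support, AddMonoidAlgebra.single (Finsupp.linearCombination ℕ g l)
        (p.coeff l * (C l : R)) := by
    rw [MvPolynomial.aeval_def, MvPolynomial.eval₂_eq]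
    refine Finset.sum_congr rfl fun l _ ↦ ?_
    simp [C, Finsupp.prod, Finsupp.linearCombination_apply, Finsupp.sum,
      AddMonoidAlgebra.single_pow, AddMonoidAlgebra.single_mul_single]
  have h := congrArg (fun x ↦ x.coeff (Finsupp.linearCombination ℕ g l₀)) (hp'.symm.trans hp)
  simp only [AddMonoidAlgebra.coeff_sum, Finsupp.finsetSum_apply, AddMonoidAlgebra.coeff_single,
    Finsupp.single_apply, hg.eq_iff, AddMonoidAlgebra.coeff_zero, Finsupp.coe_zero,
    Pi.zero_apply, Finset.sum_ite_eq'] at h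
  by_cases hl : l₀ ∈ p.support
  · simpa [hl] using h
  · simpa using hl

theorem AddMonoidAlgebra.exists_eq_single_of_isUnit {R G : Type*} [CommRing R] [IsDomain R]
    [AddCommMonoid G] [TwoUniqueSums G] {x : AddMonoidAlgebra R G} (hx : IsUnit x) :
    ∃ (g : G) (c : Rˣ), x = AddMonoidAlgebra.single g (c : R) := by
  classical
  obtain ⟨y, hxy⟩ := hx.exists_right_inv
  have hx0 : x.coeff.support.Nonempty := by
    rw [Finsupp.support_nonempty_iff, Ne, AddMonoidAlgebra.coeff_eq_zero]
    exact hx.ne_zero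
  have hy0 : y.coeff.support.Nonempty := by
    rw [Finsupp.support_nonempty_iff, Ne, AddMonoidAlgebra.coeff_eq_zero]
    rintro rfl
    simp at hxy
  have hzero {a b : G} (ha : a ∈ x.coeff.support) (hb : b ∈ y.coeff.support)
      (h : UniqueAdd x.coeff.support y.coeff.support a b) : a + b = 0 := by
    by_contra hne
    have := AddMonoidAlgebra.coeff_mul_add_of_uniqueAdd h
    rw [hxy, AddMonoidAlgebra.one_def, AddMonoidAlgebra.coeff_single,
      Finsupp.single_eq_of_ne hne] at this
    exact mul_ne_zero (Finsupp.mem_support_iff.1 ha) (Finsupp.mem_support_iff.1 hb) this.symm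
  have hcard : x.coeff.support.card * y.coeff.support.card ≤ 1 := by
    by_contra! hlt
    obtain ⟨p, hp, q, hq, hpq, hup, huq⟩ := TwoUniqueSums.uniqueAdd_of_one_lt_card hlt
    rw [Finset.mem_product] at hp hq
    obtain ⟨h1, h2⟩ := huq hp.1 hp.2 ((hzero hp.1 hp.2 hup).trans (hzero hq.1 hq.2 huq).symm)
    exact hpq (Prod.ext h1 h2)
  have hx1 : x.coeff.support.card = 1 :=
    Nat.eq_one_of_mul_eq_one_right (hcard.antisymm (Nat.mul_pos hx0.card_pos hy0.card_pos))
  have hy1 : y.coeff.support.card = 1 :=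
    Nat.eq_one_of_mul_eq_one_left (hcard.antisymm (Nat.mul_pos hx0.card_pos hy0.card_pos))
  obtain ⟨a, r, -, hxa⟩ := Finsupp.card_support_eq_one'.1 hx1
  obtain ⟨b, s, -, hyb⟩ := Finsupp.card_support_eq_one'.1 hy1
  replace hxa : x = AddMonoidAlgebra.single a r := AddMonoidAlgebra.coeff_injective hxa
  replace hyb : y = AddMonoidAlgebra.single b s := AddMonoidAlgebra.coeff_injective hyb
  have hrs : r * s = 1 := by
    rw [hxa, hyb, AddMonoidAlgebra.single_mul_single, AddMonoidAlgebra.one_def] at hxy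
    have h := congrArg (fun z ↦ z.coeff (0 : G)) hxy
    simp only [AddMonoidAlgebra.coeff_single, Finsupp.single_apply, if_true] at h
    split_ifs at h
    · exact h
    · simp at h
  exact ⟨a, Units.mkOfMulEqOne r s hrs, hxa⟩

theorem AddMonoidAlgebra.algebraicIndependent_of_injective_urGroup_prod {ι R G : Type*}
    [CommRing R] [IsDomain R] [AddCommMonoid G] [TwoUniqueSums G]
    (A : Subalgebra R (AddMonoidAlgebra R G)) {u : ι → Aˣ}
    (hu : Function.Injective fun l : ι →₀ ℕ ↦ l.prod fun i n ↦ (u i : URGroup R A) ^ n) :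
    AlgebraicIndependent R (fun i ↦ (u i : A)) := by
  have hunit (i : ι) : IsUnit ((u i : A) : AddMonoidAlgebra R G) := (u i).isUnit.map A.val
  choose g c hgc using fun i ↦ AddMonoidAlgebra.exists_eq_single_of_isUnit (hunit i)
  have hprod (l : ι →₀ ℕ) : ((l.prod fun i n ↦ (u i : A) ^ n : A) : AddMonoidAlgebra R G) =
      AddMonoidAlgebra.single (Finsupp.linearCombination ℕ g l)
        ((l.prod fun i n ↦ c i ^ n : Rˣ) : R) := by
    simp [Finsupp.prod, Finsupp.linearCombination_apply, Finsupp.sum, hgc,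
      AddMonoidAlgebra.single_pow]
  have hg : LinearIndependent ℕ g := fun l l' h ↦ by
    refine hu ((urGroup_prod_eq_iff u l l').2
      ⟨(l.prod fun i n ↦ c i ^ n) * (l'.prod fun i n ↦ c i ^ n)⁻¹, Subtype.ext ?_⟩)
    rw [MulMemClass.coe_mul, hprod, hprod, h, Subalgebra.coe_algebraMap,
      AddMonoidAlgebra.coe_algebraMap]
    simp [AddMonoidAlgebra.single_mul_single]
  have := AddMonoidAlgebra.algebraicIndependent_single c hg
  simp_rw [← hgc] at this
  exact AlgebraicIndependent.of_comp A.val this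

theorem MixedLaurent.subalgebra_eq_top {R : Type*} [CommRing R] {d m : ℕ}
    (S : Subalgebra R (MixedLaurent R d m))
    (hX : ∀ i, AddMonoidAlgebra.single (Pi.single i 1, 0) 1 ∈ S)
    (hXinv : ∀ i, AddMonoidAlgebra.single (Pi.single i (-1), 0) 1 ∈ S)
    (hY : ∀ j, AddMonoidAlgebra.single (0, Pi.single j 1) 1 ∈ S) : S = ⊤ := by
  classical
  let M : AddSubmonoid ((Fin d → ℤ) × (Fin m → ℕ)) :=
    { carrier := {g | (AddMonoidAlgebra.single g 1 : MixedLaurent R d m) ∈ S}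
      zero_mem' := S.one_mem
      add_mem' := fun {a b} ha hb ↦ by
        simpa [AddMonoidAlgebra.single_mul_single] using S.mul_mem ha hb }
  have hX' (i : Fin d) (z : ℤ) : (Pi.single i z, 0) ∈ M := by
    obtain ⟨n, rfl | rfl⟩ := z.eq_nat_or_neg
    · convert M.nsmul_mem (hX i) n using 1
      simp [← Pi.single_smul]
    · convert M.nsmul_mem (hXinv i) n using 1
      simp [← Pi.single_smul]
  have hY' (j : Fin m) (n : ℕ) : (0, Pi.single j n) ∈ M := by
    convert M.nsmul_mem (hY j) n using 1
    simp [← Pi.single_smul]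
  have hM (g : (Fin d → ℤ) × (Fin m → ℕ)) : g ∈ M := by
    have hg : g = ∑ i, (Pi.single i (g.1 i), 0) + ∑ j, (0, Pi.single j (g.2 j)) := by
      ext <;> simp [Prod.fst_sum, Prod.snd_sum, Finset.univ_sum_single]
    rw [hg]
    exact M.add_mem (M.sum_mem fun i _ ↦ hX' i _) (M.sum_mem fun j _ ↦ hY' j _)
  refine eq_top_iff.2 fun x _ ↦ ?_
  induction x using AddMonoidAlgebra.induction_on with
  | of g => exact hM g
  | add x y hx hy => exact S.add_mem (hx trivial) (hy trivial)
  | smul r x hx => exact S.smul_mem (hx trivial) r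

theorem MixedLaurent.single_mul_single_neg (R : Type*) [CommRing R] {d m : ℕ} (i : Fin d) :
    (AddMonoidAlgebra.single (Pi.single i 1, 0) 1 : MixedLaurent R d m) *
      AddMonoidAlgebra.single (Pi.single i (-1), 0) 1 = 1 := by
  simp [AddMonoidAlgebra.single_mul_single, ← Pi.single_add, AddMonoidAlgebra.one_def,
    ← Prod.zero_eq_mk]

/-- The transcendence degree of a domain that is a quotient of the mixed Laurent/polynomial ring
is at most the rank of its units plus the number of polynomial variables. -/
theorem MixedLaurent.trdeg_le_of_surjective {R A : Type*} [CommRing R] [IsDomain R] [CommRing A]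
    [IsDomain A] [Algebra R A] [FaithfulSMul R A] {d m : ℕ} (f : MixedLaurent R d m →ₐ[R] A)
    (hf : Function.Surjective f) :
    trdeg R A ≤ groupRank (URGroup R A) + m := by
  let X (i : Fin d) : Aˣ := Units.map (f : MixedLaurent R d m →* A) (Units.mkOfMulEqOne _ _ (single_mul_single_neg R i))
  let Y (j : Fin m) : A := f (AddMonoidAlgebra.single (0, Pi.single j 1) 1)
  let s : Set A := Set.range (fun i ↦ (X i : A)) ∪ Set.range Y
  let C := (Subalgebra.algebraicClosure (Algebra.adjoin R s) A).restrictScalars R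
  have hs {a : A} (ha : a ∈ s) : a ∈ C :=
    isAlgebraic_algebraMap (⟨a, Algebra.subset_adjoin ha⟩ : Algebra.adjoin R s)
  have hC : C.comap f = ⊤ := by
    refine subalgebra_eq_top _ (fun i ↦ hs (Or.inl ⟨i, rfl⟩)) (fun i ↦ ?_)
      (fun j ↦ hs (Or.inr ⟨j, rfl⟩))
    let : Invertible (X i : A) := (X i).invertible
    exact IsAlgebraic.invOf (x := (X i : A)) (hs (Or.inl ⟨i, rfl⟩))
  have : Algebra.IsAlgebraic (Algebra.adjoin R s) A := ⟨fun a ↦ by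
    obtain ⟨b, rfl⟩ := hf a
    exact (hC ▸ Algebra.mem_top : b ∈ C.comap f)⟩
  obtain ⟨t, hts, ht⟩ := exists_isTranscendenceBasis_subset (R := R) s
  have hunit (a : ↥(t ∩ Set.range fun i ↦ (X i : A))) : ∃ u : Aˣ, (u : A) = a := by
    obtain ⟨i, hi⟩ := a.2.2
    exact ⟨X i, hi⟩
  choose u hu using hunit
  have hind : AlgebraicIndependent R (fun a ↦ (u a : A)) := by
    simp_rw [hu]
    exact ht.1.mono Set.inter_subset_left
  have hle : Cardinal.mk ↥(t ∩ Set.range fun i ↦ (X i : A)) ≤ groupRank (URGroup R A) :=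
    mk_le_groupRank hind.injective_urGroup_prod
  have hY : Cardinal.mk (Set.range Y) ≤ m := by
    simpa using Cardinal.mk_range_le_lift (f := Y)
  calc trdeg R A = Cardinal.mk t := ht.cardinalMk_eq_trdeg.symm
    _ ≤ Cardinal.mk ↥((t ∩ Set.range fun i ↦ (X i : A)) ∪ Set.range Y) :=
        Cardinal.mk_le_mk_of_subset fun a ha ↦ (hts ha).imp (fun h ↦ ⟨ha, h⟩) id
    _ ≤ _ := Cardinal.mk_union_le _ _
    _ ≤ _ := add_le_add hle hY

/-- Let `R` be an integral domain, `1 ≤ d`, `B = R[x₁^{±1}, …, x_d^{±1}, x_{d+1}, …, xₙ]`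
(with `n = d + m`), `φ` an idempotent `R`-algebra endomorphism of `B`, `A = φ(B)` and
`r = rank U_R(A)`.  Then `r ≤ tr.deg_R A ≤ r + n − d`. -/
theorem trdeg_retract_bounds (R : Type*) [CommRing R] [IsDomain R] (d m : ℕ) (hd : 1 ≤ d)
    (φ : MixedLaurent R d m →ₐ[R] MixedLaurent R d m) (hφ : φ.comp φ = φ)
    (r : ℕ) (hr : groupRank (URGroup R φ.range) = (r : Cardinal)) :
    (r : Cardinal) ≤ trdeg R φ.range ∧ trdeg R φ.range ≤ ((r + m : ℕ) : Cardinal) := by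
  constructor
  · obtain ⟨v, hv⟩ := exists_injective_of_natCast_le_groupRank hr.ge
    choose u hu using fun i ↦ QuotientGroup.mk_surjective (v i)
    obtain rfl : (fun i ↦ (u i : URGroup R φ.range)) = v := funext hu
    have h := (AddMonoidAlgebra.algebraicIndependent_of_injective_urGroup_prod
      φ.range hv).lift_cardinalMk_le_trdeg
    rwa [Cardinal.mk_fin, Cardinal.lift_natCast, Cardinal.lift_id'] at h
  · have : IsDomain (MixedLaurent R d m) := NoZeroDivisors.to_isDomain _
    have : FaithfulSMul R φ.range := by
      rw [faithfulSMul_iff_algebraMap_injective]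
      refine Function.Injective.of_comp (f := φ.range.val) ?_
      exact FaithfulSMul.algebraMap_injective R (MixedLaurent R d m)
    simpa [hr] using MixedLaurent.trdeg_le_of_surjective φ.rangeRestrict φ.rangeRestrict_surjective
end

section
/- Let R be an integral domain, 1 ≤ d ≤ n, B = R[x₁^{±1}, …, x_d^{±1}, x_{d+1}, …, xₙ], φ : B → B an R-algebra homomorphism with φ ∘ φ = φ, A = φ(B), and r the rank of U_R(A) = A^*/R^*. If tr.deg_R A = r + n − d, then A is R-algebra isomorphic to R^{[±r]} ⊗_R R^{[n−d]}, the mixed Laurent/polynomial ring R[y₁^{±1}, …, y_r^{±1}, z₁, …, z_{n−d}]. -/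
namespace AddMonoidAlgebra

variable {R M : Type*} [CommRing R] [NoZeroDivisors R]

/-- A factor of a nonzero monomial is a monomial, when the exponents have two unique sums. -/
theorem exists_eq_single_of_mul_eq_single [AddMonoid M] [TwoUniqueSums M]
    {x y : AddMonoidAlgebra R M} {a : M} {c : R} (hc : c ≠ 0) (h : x * y = single a c) :
    ∃ b s, x = single b s := by
  have hx : x ≠ 0 := by
    rintro rfl
    exact hc (single_eq_zero.1 (by rw [← h, zero_mul]))
  have hy : y ≠ 0 := by
    rintro rfl
    exact hc (single_eq_zero.1 (by rw [← h, mul_zero]))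
  have hx' : 0 < x.coeff.support.card := by
    simpa [Finset.card_pos, Finsupp.support_nonempty_iff] using hx
  have hy' : 0 < y.coeff.support.card := by
    simpa [Finset.card_pos, Finsupp.support_nonempty_iff] using hy
  have key : ∀ p ∈ x.coeff.support ×ˢ y.coeff.support,
      UniqueAdd x.coeff.support y.coeff.support p.1 p.2 → p.1 + p.2 = a := by
    intro p hp hu
    by_contra hne
    have h1 := coeff_mul_add_of_uniqueAdd hu
    rw [h, coeff_single, Finsupp.single_eq_of_ne hne] at h1
    rw [Finset.mem_product, Finsupp.mem_support_iff, Finsupp.mem_support_iff] at hp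
    exact mul_ne_zero hp.1 hp.2 h1.symm
  by_cases hcard : 1 < x.coeff.support.card * y.coeff.support.card
  · obtain ⟨p, hp, q, hq, hpq, hup, huq⟩ := TwoUniqueSums.uniqueAdd_of_one_lt_card hcard
    have hq' := Finset.mem_product.1 hq
    have := hup hq'.1 hq'.2 ((key q hq huq).trans (key p hp hup).symm)
    exact absurd (Prod.ext this.1.symm this.2.symm) hpq
  · obtain ⟨b, hb⟩ := Finset.card_eq_one.1
      (show x.coeff.support.card = 1 by nlinarith)
    obtain ⟨s, -, hs⟩ := Finsupp.support_eq_singleton'.1 hb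
    exact ⟨b, s, coeff_injective hs⟩

/-- If a positive power of a divisor of one is a constant, so is that divisor. -/
theorem exists_eq_algebraMap_of_pow_eq [AddCommMonoid M] [TwoUniqueSums M] [Nontrivial R]
    [IsAddTorsionFree M] {x y : AddMonoidAlgebra R M} (hxy : x * y = 1) {n : ℕ} (hn : n ≠ 0)
    {c : R} (h : x ^ n = algebraMap R _ c) : ∃ s, x = algebraMap R _ s := by
  obtain ⟨b, s, rfl⟩ := exists_eq_single_of_mul_eq_single one_ne_zero hxy
  have hs : s ≠ 0 := by
    rintro rfl
    simp at hxy
  rw [single_pow, coe_algebraMap, Function.comp_apply, Algebra.algebraMap_self_apply,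
    single_inj] at h
  obtain ⟨h, -⟩ | ⟨h, -⟩ := h
  · obtain rfl := (nsmul_eq_zero_iff_right hn).1 h
    exact ⟨s, rfl⟩
  · exact absurd h (pow_ne_zero n hs)

end AddMonoidAlgebra

/-- Up to its kernel, a linear map from a finite module over a principal ideal domain to a
torsion-free module factors through a free module of rank at most that of the target. -/
theorem LinearMap.exists_fin_lift {S V W : Type*} [CommRing S] [IsDomain S]
    [IsPrincipalIdealRing S] [AddCommGroup V] [Module S V] [Module.Finite S V] [AddCommGroup W]
    [Module S W] [Module.IsTorsionFree S W] (f : V →ₗ[S] W) {r : ℕ}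
    (hr : Module.rank S W = r) :
    ∃ s ≤ r, ∃ g : (Fin s → S) →ₗ[S] V, ∀ v, ∃ k, f (g k) = f v := by
  let e := (Module.finBasis S (LinearMap.range f)).equivFun
  obtain ⟨g, hg⟩ := Module.projective_lifting_property f.rangeRestrict e.symm.toLinearMap
    f.surjective_rangeRestrict
  refine ⟨_, ?_, g, fun v ↦ ⟨e (f.rangeRestrict v), ?_⟩⟩
  · rw [← Nat.cast_le (α := Cardinal), Module.finrank_eq_rank, ← hr]
    exact Submodule.rank_le _
  · have := congrArg Subtype.val (LinearMap.congr_fun hg (e (f.rangeRestrict v)))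
    simpa using this

/-- Up to its kernel, a homomorphism to a torsion-free abelian group of finite rank factors through
a free abelian group of at most that rank. -/
theorem AddMonoidHom.exists_fin_lift_of_groupRank_eq {V G : Type*} [AddCommGroup V]
    [Module.Finite ℤ V] [CommGroup G] [IsMulTorsionFree G] (f : V →+ Additive G) {r : ℕ}
    (hr : groupRank G = r) :
    ∃ s ≤ r, ∃ g : (Fin s → ℤ) →+ V, ∀ v, ∃ k, f (g k) = f v := by
  obtain ⟨s, hs, g, hg⟩ := f.toIntLinearMap.exists_fin_lift hr
  exact ⟨s, hs, g.toAddMonoidHom, hg⟩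

namespace MixedLaurent

open AddMonoidAlgebra

variable (R : Type*) [CommRing R] (s m : ℕ)

/-- The polynomial ring in the variables of the mixed ring, mapped to the mixed ring. -/
noncomputable def ofMvPolynomial : MvPolynomial (Fin s ⊕ Fin m) R →ₐ[R] MixedLaurent R s m :=
  MvPolynomial.aeval <| Sum.elim (fun i ↦ single (Pi.single i 1, 0) 1)
    (fun j ↦ single (0, Pi.single j 1) 1)

variable {R s m}

theorem single_mem_range_ofMvPolynomial (k : Fin s → ℕ) (c : Fin m → ℕ) :
    (single (fun i ↦ (k i : ℤ), c) 1 : MixedLaurent R s m) ∈ (ofMvPolynomial R s m).range := by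
  refine ⟨(∏ i, MvPolynomial.X (.inl i) ^ k i) * ∏ j, MvPolynomial.X (.inr j) ^ c j, ?_⟩
  change ofMvPolynomial R s m _ = _
  simp only [ofMvPolynomial, map_mul, map_prod, map_pow, MvPolynomial.aeval_X, Sum.elim_inl,
    Sum.elim_inr, single_pow, prod_single, single_mul_single, one_pow, Finset.prod_const_one,
    mul_one]
  congr 1
  ext i
  · simp [Prod.fst_sum, Finset.sum_apply, Pi.single_apply]
  · simp [Prod.snd_sum, Finset.sum_apply, Pi.single_apply]

/-- Every element of the mixed ring becomes a polynomial after multiplication by a monomial. -/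
theorem exists_mul_single_mem_range (p : MixedLaurent R s m) :
    ∃ k : Fin s → ℕ, p * single (fun i ↦ (k i : ℤ), 0) 1 ∈ (ofMvPolynomial R s m).range := by
  induction p using AddMonoidAlgebra.induction_linear with
  | zero => exact ⟨0, by simp [zero_mem]⟩
  | add p q hp hq =>
    obtain ⟨k, hk⟩ := hp
    obtain ⟨l, hl⟩ := hq
    refine ⟨k + l, ?_⟩
    have h : (single (fun i ↦ ((k + l) i : ℤ), 0) 1 : MixedLaurent R s m) =
        single (fun i ↦ (k i : ℤ), 0) 1 * single (fun i ↦ (l i : ℤ), 0) 1 := by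
      rw [single_mul_single, mul_one, Prod.mk_add_mk, add_zero]
      congr 2
    have : (p + q) * single (fun i ↦ ((k + l) i : ℤ), 0) 1 =
        (p * single (fun i ↦ (k i : ℤ), 0) 1) * single (fun i ↦ (l i : ℤ), 0) 1 +
        (q * single (fun i ↦ (l i : ℤ), 0) 1) * single (fun i ↦ (k i : ℤ), 0) 1 := by
      rw [h]
      ring
    rw [this]
    exact add_mem (mul_mem hk (single_mem_range_ofMvPolynomial l 0))
      (mul_mem hl (single_mem_range_ofMvPolynomial k 0))
  | single a c =>
    refine ⟨fun i ↦ (-a.1 i).toNat, ?_⟩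
    have : (single a c * single (fun i ↦ (((-a.1 i).toNat : ℕ) : ℤ), 0) 1 : MixedLaurent R s m) =
        c • single (fun i ↦ (((a.1 i).toNat : ℕ) : ℤ), a.2) 1 := by
      rw [single_mul_single, smul_single, smul_eq_mul]
      congr 1
      ext i
      · simp only [Prod.fst_add, Pi.add_apply]
        omega
      · simp
    rw [this]
    exact Subalgebra.smul_mem _ (single_mem_range_ofMvPolynomial _ _) c

theorem isUnit_single (a : Fin s → ℤ) : IsUnit (single (a, 0) 1 : MixedLaurent R s m) :=
  .of_mul_eq_one (single (-a, 0) 1) (by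
    simp [single_mul_single, one_def, ← Prod.zero_eq_mk])

/-- A surjection from a mixed ring onto a domain whose transcendence degree is at least the number
of variables is injective, and the transcendence degree equals that number. -/
theorem injective_and_trdeg_eq_of_le_trdeg {A : Type*} [IsDomain R] [CommRing A] [IsDomain A]
    [Algebra R A] [FaithfulSMul R A] (θ : MixedLaurent R s m →ₐ[R] A) (hθ : Function.Surjective θ)
    (h : ((s + m : ℕ) : Cardinal) ≤ Algebra.trdeg R A) :
    Function.Injective θ ∧ Algebra.trdeg R A = (s + m : ℕ) := by
  let t : Fin s ⊕ Fin m → A := fun i ↦ θ (ofMvPolynomial R s m (.X i))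
  have ht : θ.comp (ofMvPolynomial R s m) = MvPolynomial.aeval t := by
    ext i
    simp [t]
  have hmem (x) (hx : x ∈ (ofMvPolynomial R s m).range) :
      θ x ∈ Algebra.adjoin R (Set.range t) := by
    obtain ⟨q, rfl⟩ := hx
    rw [Algebra.adjoin_range_eq_range_aeval, ← ht]
    exact ⟨q, rfl⟩
  have : Algebra.IsAlgebraic (Algebra.adjoin R (Set.range t)) A := by
    refine ⟨fun a ↦ ?_⟩
    obtain ⟨p, rfl⟩ := hθ a
    obtain ⟨k, hk⟩ := exists_mul_single_mem_range p
    refine IsAlgebraic.of_mul (y := θ (single (fun i ↦ (k i : ℤ), 0) 1))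
      ((isUnit_single _).map θ).mem_nonZeroDivisors
      (isAlgebraic_algebraMap (⟨_, hmem _ (single_mem_range_ofMvPolynomial k 0)⟩ :
        Algebra.adjoin R (Set.range t))) ?_
    rw [mul_comm, ← map_mul]
    exact isAlgebraic_algebraMap (⟨_, hmem _ hk⟩ : Algebra.adjoin R (Set.range t))
  have hb := Algebra.IsAlgebraic.isTranscendenceBasis_of_lift_le_trdeg_of_finite R t
    (by simpa using h)
  refine ⟨(injective_iff_map_eq_zero θ).2 fun p hp ↦ ?_,
    by simpa using hb.lift_cardinalMk_eq_trdeg.symm⟩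
  obtain ⟨k, q, hq⟩ := exists_mul_single_mem_range p
  have hq0 : MvPolynomial.aeval t q = 0 := by
    rw [← ht]
    change θ ((ofMvPolynomial R s m).toRingHom q) = 0
    rw [hq, map_mul, hp, zero_mul]
  obtain rfl := (injective_iff_map_eq_zero _).1 hb.1 q hq0
  rw [map_zero] at hq
  exact ((isUnit_single _).mul_left_eq_zero).1 hq.symm

/-- A domain onto which a mixed ring surjects is a mixed ring as soon as its units modulo constants
are torsion-free and its transcendence degree exceeds their rank by the number of polynomial
variables. -/
theorem nonempty_algEquiv_of_surjective {A : Type*} [IsDomain R] [CommRing A] [IsDomain A]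
    [Algebra R A] [FaithfulSMul R A] [IsMulTorsionFree (URGroup R A)] {d r : ℕ}
    (π : MixedLaurent R d m →ₐ[R] A) (hπ : Function.Surjective π)
    (hr : groupRank (URGroup R A) = r) (htr : Algebra.trdeg R A = (r + m : ℕ)) :
    Nonempty (A ≃ₐ[R] MixedLaurent R r m) := by
  let u : Multiplicative (Fin d → ℤ) →* Aˣ := MonoidHom.toHomUnits
    (((π : MixedLaurent R d m →* A).comp (of R _)).comp
      (AddMonoidHom.toMultiplicative (AddMonoidHom.inl (Fin d → ℤ) (Fin m → ℕ))))
  have hu (a) : (u (.ofAdd a) : A) = π (single (a, 0) 1) := rfl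
  obtain ⟨s, hsr, g, hg⟩ := AddMonoidHom.exists_fin_lift_of_groupRank_eq
    (MonoidHom.toAdditiveRight
      ((QuotientGroup.mk' (Units.map (algebraMap R A : R →* A)).range).comp u)) hr
  let θ : MixedLaurent R s m →ₐ[R] A := π.comp
    (mapDomainAlgHom R R (g.prodMap (AddMonoidHom.id (Fin m → ℕ))))
  have hθ' (k c) : θ (single (k, c) 1) = π (single (g k, c) 1) := by
    simp [θ]
  have hθ : Function.Surjective θ := by
    rw [← AlgHom.range_eq_top, eq_top_iff]
    rintro x -
    obtain ⟨p, rfl⟩ := hπ x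
    induction p using AddMonoidAlgebra.induction_on with
    | of b =>
      obtain ⟨a, c⟩ := b
      obtain ⟨k, hk⟩ := hg a
      obtain ⟨v, hv⟩ := QuotientGroup.eq.1
        (show (QuotientGroup.mk (u (.ofAdd (g k))) : URGroup R A) = QuotientGroup.mk _ from hk)
      have hv' : (u (.ofAdd a) : A) = algebraMap R A v * u (.ofAdd (g k)) := by
        rw [eq_inv_mul_iff_mul_eq, mul_comm] at hv
        rw [← hv]
        rfl
      refine ⟨(v : R) • single (k, c) 1, ?_⟩
      have hsplit (a) : (single (a, c) 1 : MixedLaurent R d m) =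
          single (a, 0) 1 * single (0, c) 1 := by
        simp [single_mul_single]
      change θ _ = π (single (a, c) 1)
      rw [map_smul, hθ', hsplit, hsplit a, map_mul, map_mul, ← hu, ← hu, hv', Algebra.smul_def,
        mul_assoc]
    | add p q hp hq => simpa using add_mem hp hq
    | smul c p hp => simpa using Subalgebra.smul_mem _ hp c
  obtain ⟨hinj, hs⟩ := injective_and_trdeg_eq_of_le_trdeg θ hθ
    (by rw [htr]; exact_mod_cast Nat.add_le_add_right hsr m)
  obtain rfl : r = s := by
    rw [htr, Nat.cast_inj] at hs
    omega
  exact ⟨(AlgEquiv.ofBijective θ ⟨hinj, hθ⟩).symm⟩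

instance isMulTorsionFree_urGroup {d : ℕ} [IsDomain R] (S : Subalgebra R (MixedLaurent R d m)) :
    IsMulTorsionFree (URGroup R S) := by
  refine IsMulTorsionFree.of_not_isOfFinOrder (G := URGroup R S) fun x hx hfin ↦ hx ?_
  obtain ⟨n, hn, h⟩ := isOfFinOrder_iff_pow_eq_one.1 hfin
  obtain ⟨u, rfl⟩ := QuotientGroup.mk_surjective x
  rw [← QuotientGroup.mk_pow, QuotientGroup.eq_one_iff] at h
  rw [QuotientGroup.eq_one_iff]
  obtain ⟨c, hc⟩ := h
  have const {w : Sˣ} {n : ℕ} (hn : n ≠ 0) {c : R} (h : w ^ n = algebraMap R S c) :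
      ∃ t, (w : S) = algebraMap R S t := by
    obtain ⟨t, ht⟩ := exists_eq_algebraMap_of_pow_eq
      (x := ((w : S) : MixedLaurent R d m)) (y := ((w⁻¹ : Sˣ) : S))
      (by exact_mod_cast congrArg Subtype.val w.mul_inv) hn (congrArg Subtype.val h)
    exact ⟨t, Subtype.ext ht⟩
  obtain ⟨t, ht⟩ := const hn.ne' (by simpa using (congrArg Units.val hc).symm)
  obtain ⟨t', ht'⟩ := const (w := u⁻¹) hn.ne' (c := ((c⁻¹ : Rˣ) : R)) (by
    simpa using (congrArg (fun v ↦ ((v⁻¹ : Sˣ) : S)) hc).symm)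
  have hinj : Function.Injective (algebraMap R S) := FaithfulSMul.algebraMap_injective R S
  have h1 : t * t' = 1 := hinj (by rw [map_mul, ← ht, ← ht', map_one, Units.mul_inv])
  exact ⟨⟨t, t', h1, by rw [mul_comm, h1]⟩, Units.ext ht.symm⟩

end MixedLaurent

/-- Let `R` be an integral domain, `1 ≤ d`, `B = R[x₁^{±1}, …, x_d^{±1}, x_{d+1}, …, xₙ]`
(with `n = d + m`), `φ` an idempotent `R`-algebra endomorphism of `B`, `A = φ(B)` and
`r = rank U_R(A)`.  If `tr.deg_R A = r + n − d` then `A ≅ R^{[±r]} ⊗_R R^{[n−d]}`, the mixed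
Laurent/polynomial ring `R[y₁^{±1}, …, y_r^{±1}, z₁, …, z_{n−d}]`, as `R`-algebras. -/
theorem retract_isMixed_of_trdeg_eq_max (R : Type*) [CommRing R] [IsDomain R] (d m : ℕ)
    (hd : 1 ≤ d)
    (φ : MixedLaurent R d m →ₐ[R] MixedLaurent R d m) (hφ : φ.comp φ = φ)
    (r : ℕ) (hr : groupRank (URGroup R φ.range) = (r : Cardinal))
    (htr : trdeg R φ.range = ((r + m : ℕ) : Cardinal)) :
    Nonempty (φ.range ≃ₐ[R] MixedLaurent R r m) := by
  refine MixedLaurent.nonempty_algEquiv_of_surjective φ.rangeRestrict φ.rangeRestrict_surjective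
    hr htr
end
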